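/- Let n ≤ m be natural numbers, let X be a complete metric space, let E ⊂ X be an n-rectifiable subset, and let L ≥ 0. Then the functional A_E(g) = H^n(g(E)) is lower semi-continuous on Lip_L(X, ℝ^m) with the supremum metric; equivalently, for every c ∈ ℝ the set {f ∈ Lip_L(X, ℝ^m) : H^n(f(E)) > c} is open in Lip_L(X, ℝ^m). -/

import Mathlib

open MeasureTheory Metric Set Filter Topology ENNReal

noncomputable section

abbrev Euc (n : ℕ) : Type := EuclideanSpace ℝ (Fin n)

/-- An `n`-rectifiable subset of a metric space: an `H^n`-measurable set which is, up to an
`H^n`-null set, covered by countably many Lipschitz images of subsets of `ℝ^n`. -/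
def IsRectifiable (n : ℕ) {X : Type*} [MetricSpace X] [MeasurableSpace X] [BorelSpace X]
    (E : Set X) : Prop :=
  NullMeasurableSet E μH[n] ∧
    ∃ (F : ℕ → Set (Euc n)) (f : ℕ → Euc n → X) (K : ℕ → NNReal),
      (∀ i, LipschitzOnWith (K i) (f i) (F i)) ∧
      μH[n] (E \ ⋃ i, f i '' F i) = 0

/-- The space of bounded `L`-Lipschitz functions `X → ℝ^m` with the supremum metric. -/
abbrev LipE (L : NNReal) (X : Type*) [MetricSpace X] (m : ℕ) :=
  {f : BoundedContinuousFunction X (Euc m) // LipschitzWith L ⇑f}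

/-- The determinant of `1 + A` is a universal affine combination of the determinants of `1 + t • A`
for `t` in a finite set of arbitrarily small positive parameters. -/
lemma exists_det_one_add_eq_sum (E : Type*) [NormedAddCommGroup E] [NormedSpace ℝ E]
    [FiniteDimensional ℝ E] {τ : ℝ} (hτ : 0 < τ) :
    ∃ (N : ℕ) (t w : ℕ → ℝ), (∀ i ∈ Finset.range N, 0 < t i ∧ t i ≤ τ) ∧
      ∑ i ∈ Finset.range N, w i = 1 ∧
      ∀ A : E →L[ℝ] E, ContinuousLinearMap.det (1 + A) =
        ∑ i ∈ Finset.range N, w i * ContinuousLinearMap.det (1 + t i • A) := by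
  classical
  set d := Module.finrank ℝ E
  set t : ℕ → ℝ := fun i => τ / (i + 1) with ht
  have htinj : Set.InjOn t (Finset.range (d + 1) : Finset ℕ) := by
    intro i _ j _ hij
    simp only [ht] at hij
    have hi : (0 : ℝ) < i + 1 := by positivity
    have hj : (0 : ℝ) < j + 1 := by positivity
    rw [div_eq_div_iff hi.ne' hj.ne'] at hij
    have := mul_left_cancel₀ hτ.ne' hij
    exact_mod_cast (by linarith : (i : ℝ) = j)
  refine ⟨d + 1, t, fun i => (Lagrange.basis (Finset.range (d + 1)) t i).eval 1, ?_, ?_, ?_⟩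
  · intro i _
    have hi : (1 : ℝ) ≤ i + 1 := by linarith [Nat.cast_nonneg (α := ℝ) i]
    exact ⟨by positivity, div_le_self hτ.le hi⟩
  · rw [← Polynomial.eval_finsetSum, Lagrange.sum_basis htinj (by simp), Polynomial.eval_one]
  · intro A
    set b := Module.finBasis ℝ E
    set M := LinearMap.toMatrix b b (A : E →ₗ[ℝ] E) with hM
    set P : Polynomial ℝ := ((Polynomial.X : Polynomial ℝ) • M.map ⇑(Polynomial.C (R := ℝ)) +
      (1 : Matrix (Fin d) (Fin d) ℝ).map ⇑(Polynomial.C (R := ℝ))).det with hP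
    have heval : ∀ s : ℝ, P.eval s = ContinuousLinearMap.det (1 + s • A) := by
      intro s
      have h1 : ContinuousLinearMap.det (1 + s • A) = (1 + s • M).det := by
        rw [ContinuousLinearMap.det, ← LinearMap.det_toMatrix b]
        congr 1
        simp [hM, LinearMap.toMatrix_one]
      rw [h1, hP, ← Polynomial.coe_evalRingHom, RingHom.map_det]
      congr 1
      ext i j
      by_cases hij : i = j
      · subst hij; simp [add_comm, mul_comm (M i i)]
      · simp [hij, mul_comm (M i j)]
    have hdeg : P.degree < ((Finset.range (d + 1)).card : WithBot ℕ) := by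
      have h2 : P.natDegree ≤ d :=
        (Polynomial.natDegree_det_X_add_C_le M (1 : Matrix (Fin d) (Fin d) ℝ)).trans_eq
          (Fintype.card_fin d)
      calc P.degree ≤ (P.natDegree : WithBot ℕ) := Polynomial.degree_le_natDegree
        _ < _ := by
          rw [Finset.card_range]
          exact_mod_cast Nat.lt_succ_of_le h2
    have hint := Lagrange.eq_interpolate htinj hdeg
    have h3 := congrArg (Polynomial.eval 1) hint
    rw [heval, one_smul, Lagrange.interpolate_apply, Polynomial.eval_finsetSum] at h3
    rw [h3]
    refine Finset.sum_congr rfl fun i _ => ?_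
    rw [Polynomial.eval_mul, Polynomial.eval_C, heval, mul_comm]

/-- A Lipschitz perturbation of the identity, supported in a ball, with small Lipschitz constant,
maps the ball bijectively onto itself. -/
lemma image_ball_add_of_contracting {E : Type*} [NormedAddCommGroup E] [NormedSpace ℝ E]
    [CompleteSpace E] {u : E → E} {K : NNReal} (hK : K < 1) (hu : LipschitzWith K u) {R : ℝ}
    (hR : ∀ x, R ≤ ‖x‖ → u x = 0) :
    Function.Injective (fun x => x + u x) ∧ (fun x => x + u x) '' ball 0 R = ball 0 R := by
  have hinj : Function.Injective (fun x => x + u x) := by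
    intro x y hxy
    have h1 : x - y = u y - u x := by
      have : x + u x = y + u y := hxy
      rw [sub_eq_sub_iff_add_eq_add, this, add_comm]
    have h2 : ‖x - y‖ ≤ K * ‖x - y‖ := by
      calc ‖x - y‖ = ‖u y - u x‖ := by rw [h1]
        _ ≤ K * ‖y - x‖ := hu.norm_sub_le y x
        _ = _ := by rw [norm_sub_rev]
    have hK' : (K : ℝ) < 1 := by exact_mod_cast hK
    have h3 : ‖x - y‖ = 0 := by nlinarith [norm_nonneg (x - y)]
    exact sub_eq_zero.1 (norm_eq_zero.1 h3)
  refine ⟨hinj, Subset.antisymm ?_ ?_⟩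
  · rintro _ ⟨x, hx, rfl⟩
    by_contra hcon
    simp only [mem_ball_zero_iff, not_lt] at hcon hx
    have h1 := hinj (a₁ := x + u x) (a₂ := x) (by simp [hR _ hcon])
    rw [h1] at hcon
    linarith
  · intro y hy
    have hc : ContractingWith K (fun x => y - u x) :=
      ⟨hK, LipschitzWith.of_dist_le_mul fun a b => by
        rw [dist_sub_left]; exact hu.dist_le_mul a b⟩
    have hfix : y - u (hc.fixedPoint) = hc.fixedPoint := hc.fixedPoint_isFixedPt
    set x := hc.fixedPoint
    refine ⟨x, ?_, (sub_eq_iff_eq_add.1 hfix).symm⟩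
    by_contra hcon
    simp only [mem_ball_zero_iff, not_lt] at hcon hy
    rw [hR x hcon, sub_zero] at hfix
    rw [← hfix] at hcon
    linarith

/-- The integral of the Jacobian determinant of a Lipschitz map which is the identity outside of a
ball is the measure of the ball. -/
lemma integral_det_one_add_fderiv_eq {E : Type*} [NormedAddCommGroup E] [NormedSpace ℝ E]
    [FiniteDimensional ℝ E] [MeasurableSpace E] [BorelSpace E] {u : E → E} {K : NNReal}
    (hu : LipschitzWith K u) {R : ℝ} (hR : ∀ x, R ≤ ‖x‖ → u x = 0) :
    ∫ x in ball 0 R, ContinuousLinearMap.det (1 + fderiv ℝ u x) ∂μH[Module.finrank ℝ E] =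
      (μH[Module.finrank ℝ E] : Measure E).real (ball 0 R) := by
  set μ : Measure E := μH[Module.finrank ℝ E] with hμ
  have : μ.IsAddHaarMeasure := isAddHaarMeasure_hausdorffMeasure
  have hpos : ∀ᶠ A : E →L[ℝ] E in 𝓝 1, 0 < ContinuousLinearMap.det A := by
    refine ContinuousLinearMap.continuous_det.continuousAt.eventually_const_lt ?_
    change 0 < LinearMap.det (LinearMap.id : E →ₗ[ℝ] E)
    simp
  obtain ⟨ε, hε, hball⟩ := Metric.eventually_nhds_iff.1 hpos
  set τ : ℝ := min ε 1 / (2 * (K + 1)) with hτdef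
  have hK0 : (0 : ℝ) ≤ K := K.2
  have hm : 0 < min ε 1 := lt_min hε one_pos
  have hτ : 0 < τ := by positivity
  have hτK : τ * K < min ε 1 := by
    rw [hτdef, div_mul_eq_mul_div, div_lt_iff₀ (by positivity)]
    nlinarith
  obtain ⟨N, t, w, ht, hw, hdet⟩ := exists_det_one_add_eq_sum E hτ
  have hdiff : ∀ᵐ x ∂μ, DifferentiableAt ℝ u x := hu.ae_differentiableAt
  set D : Set E := {x | DifferentiableAt ℝ u x}
  have hDm : MeasurableSet D := measurableSet_of_differentiableAt ℝ u
  set B : Set E := ball (0 : E) R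
  have hBD : (B ∩ D : Set E) =ᵐ[μ] B := by
    filter_upwards [hdiff] with x hx
    apply propext
    constructor
    · exact fun h => h.1
    · exact fun h => ⟨h, hx⟩
  have key : ∀ s : ℝ, 0 < s → s ≤ τ →
      IntegrableOn (fun x => ContinuousLinearMap.det (1 + s • fderiv ℝ u x)) B μ ∧
      ∫ x in B, ContinuousLinearMap.det (1 + s • fderiv ℝ u x) ∂μ = μ.real B := by
    intro s hs hsτ
    have hsK : s * K < min ε 1 :=
      lt_of_le_of_lt (mul_le_mul_of_nonneg_right hsτ hK0) hτK
    have hsu : LipschitzWith (s.toNNReal * K) (fun x => s • u x) := by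
      refine LipschitzWith.of_dist_le_mul fun a b => ?_
      rw [dist_smul₀, NNReal.coe_mul, Real.coe_toNNReal _ hs.le, Real.norm_of_nonneg hs.le,
        mul_assoc]
      exact mul_le_mul_of_nonneg_left (hu.dist_le_mul a b) hs.le
    have hlt : s.toNNReal * K < 1 := by
      rw [← NNReal.coe_lt_coe, NNReal.coe_mul, Real.coe_toNNReal _ hs.le]
      exact lt_of_lt_of_le hsK (min_le_right _ _)
    obtain ⟨hinj, himg⟩ := image_ball_add_of_contracting hlt hsu (R := R)
      (fun x hx => by simp [hR x hx])
    set h : E → E := fun x => x + s • u x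
    have hder : ∀ x ∈ B ∩ D, HasFDerivWithinAt h (1 + s • fderiv ℝ u x) (B ∩ D) x := by
      intro x hx
      have := hx.2.hasFDerivAt
      exact ((hasFDerivAt_id x).add (this.const_smul s)).hasFDerivWithinAt
    have hhlip : LipschitzWith (1 + s.toNNReal * K) h := LipschitzWith.id.add hsu
    have hnull : μ (h '' (B \ D)) = 0 := by
      have h0 : μ (B \ D) = 0 := measure_mono_null (fun x hx => hx.2) hdiff
      have := hhlip.hausdorffMeasure_image_le (d := (Module.finrank ℝ E : ℝ)) (by positivity)
        (B \ D)
      rw [← hμ, h0, mul_zero] at this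
      exact nonpos_iff_eq_zero.1 this
    have hmeas : μ (h '' (B ∩ D)) = μ B := by
      apply le_antisymm
      · exact (measure_mono (image_mono inter_subset_left)).trans_eq (by rw [himg])
      · calc μ B = μ (h '' (B ∩ D) ∪ h '' (B \ D)) := by
              rw [← image_union, inter_union_sdiff, himg]
          _ ≤ μ (h '' (B ∩ D)) + μ (h '' (B \ D)) := measure_union_le _ _
          _ = _ := by rw [hnull, add_zero]
    have hBDm : MeasurableSet (B ∩ D) := measurableSet_ball.inter hDm
    have hBfin : μ B ≠ ⊤ := measure_ball_lt_top.ne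
    have habs : ∀ x ∈ B ∩ D, |ContinuousLinearMap.det (1 + s • fderiv ℝ u x)| • (1 : ℝ) =
        ContinuousLinearMap.det (1 + s • fderiv ℝ u x) := by
      intro x _
      rw [smul_eq_mul, mul_one, abs_of_pos]
      apply hball
      rw [dist_eq_norm, add_sub_cancel_left, norm_smul, Real.norm_of_nonneg hs.le]
      exact lt_of_le_of_lt
        (mul_le_mul_of_nonneg_left (norm_fderiv_le_of_lipschitz ℝ hu) hs.le)
        (lt_of_lt_of_le hsK (min_le_left _ _))
    constructor
    · have h1 := (integrableOn_image_iff_integrableOn_abs_det_fderiv_smul μ hBDm hder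
        hinj.injOn (fun _ => (1 : ℝ))).1 (integrableOn_const (by rw [hmeas]; exact hBfin))
      exact (h1.congr_fun habs hBDm).congr_set_ae hBD.symm
    · have h1 := integral_image_eq_integral_abs_det_fderiv_smul μ hBDm hder
        hinj.injOn (fun _ => (1 : ℝ))
      rw [setIntegral_congr_fun hBDm habs, setIntegral_congr_set hBD] at h1
      rw [← h1]
      rw [setIntegral_const, smul_eq_mul, mul_one, measureReal_def, hmeas, measureReal_def]
  rw [integral_congr_ae (Eventually.of_forall fun x => hdet (fderiv ℝ u x)), integral_finsetSum]
  · simp_rw [integral_const_mul]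
    rw [Finset.sum_congr rfl fun i hi => by rw [(key (t i) (ht i hi).1 (ht i hi).2).2],
      ← Finset.sum_mul, hw, one_mul]
  · intro i hi
    exact (key (t i) (ht i hi).1 (ht i hi).2).1.const_mul (w i)

/-- The map pushing points radially out of the ball of radius `R` is Lipschitz away from `0`. -/
lemma norm_radial_sub_le {E : Type*} [NormedAddCommGroup E] [NormedSpace ℝ E] {ρ R : ℝ}
    (hρ : 0 < ρ) (hR : 0 ≤ R) {z w : E} (hz : ρ ≤ ‖z‖) (hw : ρ ≤ ‖w‖) :
    ‖(max (R - ‖z‖) 0 / ‖z‖) • z - (max (R - ‖w‖) 0 / ‖w‖) • w‖ ≤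
      (1 + R * (2 / ρ)) * ‖z - w‖ := by
  have hz0 : 0 < ‖z‖ := hρ.trans_le hz
  have hw0 : 0 < ‖w‖ := hρ.trans_le hw
  set a := max (R - ‖z‖) 0 with ha
  set b := max (R - ‖w‖) 0 with hb
  have hab : |a - b| ≤ ‖z - w‖ := by
    refine (abs_max_sub_max_le_abs _ _ _).trans ?_
    rw [show R - ‖z‖ - (R - ‖w‖) = -(‖z‖ - ‖w‖) by ring, abs_neg]
    exact abs_norm_sub_norm_le z w
  have haR : a ≤ R := max_le (by linarith) hR
  have ha0 : 0 ≤ a := le_max_right _ _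
  have hunit : ‖(1 / ‖z‖) • z - (1 / ‖w‖) • w‖ ≤ 2 / ρ * ‖z - w‖ := by
    have h1 : (1 / ‖z‖) • z - (1 / ‖w‖) • w =
        (1 / ‖z‖) • (z - w) + ((‖w‖ - ‖z‖) / (‖z‖ * ‖w‖)) • w := by
      rw [smul_sub, sub_add, ← sub_smul]
      congr 2
      field_simp
      ring
    rw [h1]
    refine (norm_add_le _ _).trans ?_
    rw [norm_smul, norm_smul, Real.norm_of_nonneg (by positivity), norm_div, norm_mul, norm_norm,
      norm_norm]
    have h2 : ‖‖w‖ - ‖z‖‖ ≤ ‖z - w‖ := by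
      rw [norm_sub_rev z w]; exact abs_norm_sub_norm_le w z
    calc 1 / ‖z‖ * ‖z - w‖ + ‖‖w‖ - ‖z‖‖ / (‖z‖ * ‖w‖) * ‖w‖
        = ‖z - w‖ * (1 / ‖z‖) + ‖‖w‖ - ‖z‖‖ / ‖z‖ := by field_simp
      _ ≤ ‖z - w‖ * (1 / ρ) + ‖z - w‖ / ρ := by gcongr
      _ = _ := by ring
  have h3 : (a / ‖z‖) • z - (b / ‖w‖) • w =
      a • ((1 / ‖z‖) • z - (1 / ‖w‖) • w) + (a - b) • (1 / ‖w‖) • w := by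
    rw [smul_sub, sub_smul, smul_smul, smul_smul, smul_smul]
    simp only [mul_one_div]
    abel
  rw [h3]
  refine (norm_add_le _ _).trans ?_
  rw [norm_smul, norm_smul, norm_smul, Real.norm_of_nonneg ha0, norm_div, norm_one, norm_norm,
    one_div_mul_cancel hw0.ne', mul_one, Real.norm_eq_abs]
  calc a * ‖(1 / ‖z‖) • z - (1 / ‖w‖) • w‖ + |a - b|
      ≤ R * (2 / ρ * ‖z - w‖) + ‖z - w‖ := by gcongr
    _ = _ := by ring

/-- A Lipschitz self-map of a Euclidean space which is the identity outside of a ball, and which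
maps this ball to itself, does not avoid any neighbourhood of the centre. -/
lemma exists_norm_lt_of_lipschitz_eq_id {E : Type*} [NormedAddCommGroup E]
    [InnerProductSpace ℝ E] [FiniteDimensional ℝ E] {h : E → E} {K : NNReal}
    (hh : LipschitzWith K h) {R : ℝ} (hR0 : 0 < R) (hR : ∀ x, R ≤ ‖x‖ → h x = x)
    (hmaps : ∀ x, ‖x‖ ≤ R → ‖h x‖ ≤ R) {ρ : ℝ} (hρ : 0 < ρ) : ∃ x, ‖h x‖ < ρ := by
  borelize E
  by_contra! hcon
  set g : E → E := fun x => h x + (max (R - ‖h x‖) 0 / ‖h x‖) • h x with hg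
  set u : E → E := fun x => g x - x with hudef
  have hu : LipschitzWith (K + (1 + R.toNNReal * (2 / ρ.toNNReal)) * K + 1) u := by
    refine (hh.add (LipschitzWith.of_dist_le_mul fun x y => ?_)).sub LipschitzWith.id
    rw [dist_eq_norm]
    refine (norm_radial_sub_le hρ hR0.le (hcon x) (hcon y)).trans ?_
    push_cast
    rw [Real.coe_toNNReal _ hR0.le, Real.coe_toNNReal _ hρ.le, mul_assoc]
    refine mul_le_mul_of_nonneg_left ?_ (by positivity)
    simpa only [dist_eq_norm] using hh.norm_sub_le x y
  have hu0 : ∀ x, R ≤ ‖x‖ → u x = 0 := by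
    intro x hx
    simp [hudef, hg, hR x hx, max_eq_right (sub_nonpos.2 hx)]
  have hnorm : ∀ x, ‖x‖ ≤ R → ‖g x‖ = R := by
    intro x hx
    have h1 : 0 < ‖h x‖ := hρ.trans_le (hcon x)
    have h2 : g x = (R / ‖h x‖) • h x := by
      simp only [hg]
      rw [max_eq_left (sub_nonneg.2 (hmaps x hx)), sub_div, sub_smul, div_self h1.ne', one_smul]
      abel
    rw [h2, norm_smul, norm_div, norm_norm, Real.norm_of_nonneg hR0.le, div_mul_cancel₀ _ h1.ne']
  have hint := integral_det_one_add_fderiv_eq hu hu0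
  set μ : Measure E := μH[Module.finrank ℝ E] with hμ
  have : μ.IsAddHaarMeasure := isAddHaarMeasure_hausdorffMeasure
  have hdiff : ∀ᵐ x ∂μ, DifferentiableAt ℝ u x := hu.ae_differentiableAt
  have hzero : ∀ᵐ x ∂μ.restrict (ball 0 R),
      ContinuousLinearMap.det (1 + fderiv ℝ u x) = (0 : ℝ) := by
    filter_upwards [ae_restrict_of_ae hdiff, ae_restrict_mem measurableSet_ball] with x hx hxB
    have hgd : HasFDerivAt g (1 + fderiv ℝ u x) x := by
      have h1 := (hasFDerivAt_id x).add hx.hasFDerivAt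
      refine h1.congr_of_eventuallyEq (Eventually.of_forall fun y => ?_)
      simp [hudef]
    set A := (1 : E →L[ℝ] E) + fderiv ℝ u x
    by_contra hdet
    have hconst : (fun y => inner ℝ (g y) (g y)) =ᶠ[𝓝 x] fun _ => R ^ 2 := by
      filter_upwards [isOpen_ball.mem_nhds hxB] with y hy
      rw [real_inner_self_eq_norm_sq, hnorm y (mem_ball_zero_iff.1 hy).le]
    have hd1 := (hgd.inner ℝ hgd).congr_of_eventuallyEq hconst.symm
    have hd2 := hd1.unique (hasFDerivAt_const (R ^ 2) x)
    have hsurj : Function.Surjective (A : E →ₗ[ℝ] E) :=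
      ((LinearEquiv.ofIsUnitDet (f := (A : E →ₗ[ℝ] E)) (v := Module.finBasis ℝ E)
        (v' := Module.finBasis ℝ E) (by
          rw [LinearMap.det_toMatrix]; exact isUnit_iff_ne_zero.2 hdet))).surjective
    obtain ⟨v, hv⟩ := hsurj (g x)
    have h3 := congrArg (fun T => T v) hd2
    have hv' : A v = g x := hv
    simp [fderivInnerCLM_apply, hv', hnorm x (mem_ball_zero_iff.1 hxB).le] at h3
    exact hR0.ne' h3
  rw [integral_congr_ae hzero, integral_zero] at hint
  have hball : 0 < μ.real (ball (0 : E) R) :=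
    ENNReal.toReal_pos (measure_ball_pos μ _ hR0).ne' measure_ball_lt_top.ne
  linarith

/-- A Lipschitz self-map of a Euclidean space which is the identity outside of a ball is onto. -/
lemma surjective_of_lipschitz_eq_id {E : Type*} [NormedAddCommGroup E]
    [InnerProductSpace ℝ E] [FiniteDimensional ℝ E] {h : E → E} {K : NNReal}
    (hh : LipschitzWith K h) {R : ℝ} (hR : ∀ x, R ≤ ‖x‖ → h x = x) : Function.Surjective h := by
  intro y
  by_contra hy
  have himg : IsClosed (h '' closedBall 0 R) :=
    ((isCompact_closedBall 0 R).image hh.continuous).isClosed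
  obtain ⟨ρ₁, hρ₁, hball⟩ := Metric.isOpen_iff.1 himg.isOpen_compl y
    (fun ⟨x, _, hx⟩ => hy ⟨x, hx⟩)
  have hyR : ‖y‖ < R := by
    by_contra hcon
    exact hy ⟨y, hR y (not_lt.1 hcon)⟩
  set k : E → E := fun x => h (x + y) - y with hk
  have hklip : LipschitzWith K k := LipschitzWith.of_dist_le_mul fun a b => by
    simp only [hk]
    rw [dist_sub_right]
    simpa using hh.dist_le_mul (a + y) (b + y)
  set R₁ := R + ‖y‖ with hR₁
  have hR₁0 : 0 ≤ R₁ := by linarith [norm_nonneg y]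
  have hk1 : ∀ x, R₁ ≤ ‖x‖ → k x = x := by
    intro x hx
    have : R ≤ ‖x + y‖ := by
      have := norm_sub_le (x + y) y
      rw [add_sub_cancel_right] at this
      linarith
    simp [hk, hR _ this]
  set R₂ := R₁ + (‖k 0‖ + K * R₁) with hR₂
  have hR₁₂ : R₁ ≤ R₂ := by
    have : 0 ≤ ‖k 0‖ + K * R₁ := by positivity
    linarith
  have hmaps : ∀ x, ‖x‖ ≤ R₂ → ‖k x‖ ≤ R₂ := by
    intro x hx
    rcases le_total R₁ ‖x‖ with h1 | h1
    · rwa [hk1 x h1]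
    · have h2 : ‖k x‖ ≤ ‖k 0‖ + K * ‖x‖ := by
        have h3 := hklip.norm_sub_le x 0
        have h4 := norm_add_le (k 0) (k x - k 0)
        rw [add_sub_cancel] at h4
        rw [sub_zero] at h3
        linarith
      have h5 : K * ‖x‖ ≤ K * R₁ := mul_le_mul_of_nonneg_left h1 K.2
      linarith
  obtain ⟨x, hx⟩ := exists_norm_lt_of_lipschitz_eq_id hklip
    (by linarith [norm_nonneg y] : 0 < R₂) (fun x hx => hk1 x (hR₁₂.trans hx)) hmaps
    (lt_min hρ₁ (sub_pos.2 hyR))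
  have hx' : ‖h (x + y) - y‖ < min ρ₁ (R - ‖y‖) := hx
  rcases le_total R ‖x + y‖ with h1 | h1
  · rw [hR _ h1] at hx'
    have h2 := norm_sub_norm_le (x + y) y
    have h3 := hx'.trans_le (min_le_right _ _)
    linarith
  · exact hball (mem_ball_iff_norm.2 (hx'.trans_le (min_le_left _ _)))
      ⟨x + y, mem_closedBall_zero_iff.2 h1, rfl⟩

/-- On `ℝ^n`, the Hausdorff measure of dimension `n` is a Haar measure. -/
lemma isAddHaarMeasure_hausdorffMeasure_euc (n : ℕ) :
    (μH[n] : Measure (Euc n)).IsAddHaarMeasure := by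
  simpa using isAddHaarMeasure_hausdorffMeasure (E := Euc n)

/-- If `g` contracts distances compared to `T` up to a factor `C` on a set, then so it does for the
Hausdorff measures of the images. -/
lemma hausdorffMeasure_image_le_of_dist_le {X Y Z : Type*} [MetricSpace Y]
    [MetricSpace Z] [MeasurableSpace Y] [BorelSpace Y] [MeasurableSpace Z] [BorelSpace Z]
    {g : X → Y} {T : X → Z} {S : Set X} {C : NNReal}
    (h : ∀ x ∈ S, ∀ y ∈ S, dist (g x) (g y) ≤ C * dist (T x) (T y)) (n : ℕ) :
    μH[n] (g '' S) ≤ (C : ℝ≥0∞) ^ n * μH[n] (T '' S) := by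
  rcases S.eq_empty_or_nonempty with rfl | ⟨x₀, -⟩
  · simp
  have : Nonempty X := ⟨x₀⟩
  set s : Z → X := Function.invFunOn T S with hs
  have hsS : ∀ x ∈ S, s (T x) ∈ S := fun x hx => Function.invFunOn_mem ⟨x, hx, rfl⟩
  have hTs : ∀ x ∈ S, T (s (T x)) = T x := fun x hx => Function.invFunOn_eq ⟨x, hx, rfl⟩
  have hlip : LipschitzOnWith C (g ∘ s) (T '' S) := by
    refine LipschitzOnWith.of_dist_le_mul ?_
    rintro _ ⟨x, hx, rfl⟩ _ ⟨y, hy, rfl⟩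
    simpa only [Function.comp_apply, hTs x hx, hTs y hy] using h _ (hsS x hx) _ (hsS y hy)
  have himg : (g ∘ s) '' (T '' S) = g '' S := by
    rw [image_image]
    refine image_congr fun x hx => ?_
    have := h _ (hsS x hx) _ hx
    rw [hTs x hx, dist_self, mul_zero] at this
    exact dist_le_zero.1 this
  have := hlip.hausdorffMeasure_image_le (d := (n : ℝ)) (by positivity)
  rwa [himg, ENNReal.rpow_natCast] at this

/-- A Lipschitz map which is close to the identity on a compact set `D` of `ℝ^n` agrees on `D` with
a globally Lipschitz map, uniformly close to the identity and onto. -/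
lemma exists_lipschitz_surjective_extension {n : ℕ} {D : Set (Euc n)} (hD : IsCompact D)
    (M : NNReal) :
    ∃ C c : NNReal, ∀ δ : ℝ, 0 ≤ δ → δ ≤ 1 → ∀ h : Euc n → Euc n, LipschitzOnWith M h D →
      (∀ x ∈ D, dist (h x) x ≤ δ) →
      ∃ k : Euc n → Euc n, LipschitzWith C k ∧ EqOn h k D ∧ (∀ x, dist (k x) x ≤ c * δ) ∧
        Function.Surjective k := by
  obtain ⟨R, hR⟩ := hD.isBounded.subset_closedBall 0
  set c : NNReal := (Fintype.card (Fin n) : NNReal) ^ (1 / (2 : ℝ≥0∞)).toReal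
  have hc : LipschitzWith c (WithLp.toLp 2 : (Fin n → ℝ) → Euc n) :=
    PiLp.lipschitzWith_toLp 2 (fun _ : Fin n => ℝ)
  refine ⟨1 + c * max 1 (max 1 (1 * (M + 1))), c, fun δ hδ0 hδ1 h hh hclose => ?_⟩
  have hu : LipschitzOnWith (1 * (M + 1)) (fun x => WithLp.ofLp (h x - x)) D :=
    (PiLp.lipschitzWith_ofLp 2 (fun _ : Fin n => ℝ)).comp_lipschitzOnWith
      (hh.sub LipschitzWith.id.lipschitzOnWith)
  obtain ⟨v, hv, hvD⟩ := hu.extend_pi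
  set ψ : Euc n → ℝ := fun x => min δ (max 0 (R + 1 - ‖x‖)) with hψdef
  have hψ : LipschitzWith 1 ψ := by
    have h1 : LipschitzWith 1 (fun x : Euc n => R + 1 - ‖x‖) :=
      LipschitzWith.of_dist_le_mul fun x y => by
        rw [dist_sub_left, NNReal.coe_one, one_mul, dist_eq_norm, dist_eq_norm]
        exact abs_norm_sub_norm_le x y
    have := (LipschitzWith.const (α := Euc n) δ).min
      ((LipschitzWith.const (α := Euc n) (0 : ℝ)).max h1)
    simpa [hψdef] using this
  have hψ0 : ∀ x, 0 ≤ ψ x := fun x => le_min hδ0 (le_max_left _ _)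
  have hψδ : ∀ x, ψ x ≤ δ := fun x => min_le_left _ _
  set w : Euc n → Fin n → ℝ := fun x i => max (-ψ x) (min (ψ x) (v x i)) with hwdef
  have hw : LipschitzWith (max 1 (max 1 (1 * (M + 1)))) w := by
    refine LipschitzWith.of_dist_le_mul fun x y => ?_
    refine (dist_pi_le_iff (by positivity)).2 fun i => ?_
    have hvi : LipschitzWith (1 * (M + 1)) (fun x => v x i) :=
      LipschitzWith.of_dist_le_mul fun x y => (dist_le_pi_dist _ _ i).trans (hv.dist_le_mul x y)
    exact (hψ.neg.max (hψ.min hvi)).dist_le_mul x y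
  have hwψ : ∀ x, ‖w x‖ ≤ ψ x := fun x => (pi_norm_le_iff_of_nonneg (hψ0 x)).2 fun i =>
    abs_le.2 ⟨le_max_left _ _, max_le (by linarith [hψ0 x]) (min_le_left _ _)⟩
  have hnorm : ∀ x, ‖WithLp.toLp 2 (w x)‖ ≤ c * ψ x := by
    intro x
    have h1 := hc.dist_le_mul (w x) 0
    rw [dist_zero_right, WithLp.toLp_zero, dist_zero_right] at h1
    exact h1.trans (mul_le_mul_of_nonneg_left (hwψ x) c.2)
  set k : Euc n → Euc n := fun x => x + WithLp.toLp 2 (w x) with hk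
  have hklip : LipschitzWith (1 + c * max 1 (max 1 (1 * (M + 1)))) k :=
    LipschitzWith.id.add (hc.comp hw)
  refine ⟨k, hklip, fun x hx => ?_, fun x => ?_, ?_⟩
  · have hψx : ψ x = δ := by
      have := mem_closedBall_zero_iff.1 (hR hx)
      exact min_eq_left ((by linarith : δ ≤ R + 1 - ‖x‖).trans (le_max_right _ _))
    have hvx : ∀ i, |v x i| ≤ δ := by
      intro i
      rw [← hvD hx]
      calc |(h x - x) i| ≤ ‖h x - x‖ := PiLp.norm_apply_le (h x - x) i
        _ ≤ δ := by rw [← dist_eq_norm]; exact hclose x hx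
    have hwx : w x = v x := by
      funext i
      have := abs_le.1 (hvx i)
      simp only [hwdef, hψx]
      rw [min_eq_right this.2, max_eq_right this.1]
    simp only [hk]
    rw [hwx, ← hvD hx]
    simp
  · rw [dist_eq_norm]
    simp only [hk, add_sub_cancel_left]
    exact (hnorm x).trans (mul_le_mul_of_nonneg_left (hψδ x) c.2)
  · refine surjective_of_lipschitz_eq_id hklip (R := R + 1) fun x hx => ?_
    have hψx : ψ x = 0 := le_antisymm
      ((min_le_right _ _).trans_eq (max_eq_left (by linarith))) (hψ0 x)
    have h1 := hnorm x
    rw [hψx, mul_zero] at h1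
    simp only [hk]
    rw [norm_le_zero_iff.1 h1, add_zero]

/-- Lower semicontinuity at the identity of the measure of the image of a compact set in `ℝ^n`,
among uniformly Lipschitz maps. -/
lemma exists_measure_le_measure_image_add {n : ℕ} {D : Set (Euc n)} (hD : IsCompact D)
    (M : NNReal) {η : ℝ≥0∞} (hη : η ≠ 0) :
    ∃ δ > 0, ∀ h : Euc n → Euc n, LipschitzOnWith M h D → (∀ x ∈ D, dist (h x) x ≤ δ) →
      μH[n] D ≤ μH[n] (h '' D) + η := by
  have := isAddHaarMeasure_hausdorffMeasure_euc n
  obtain ⟨C, c, hext⟩ := exists_lipschitz_surjective_extension hD M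
  set κ : ℝ≥0∞ := (C : ℝ≥0∞) ^ n
  have hκ : κ ≠ ⊤ := ENNReal.pow_ne_top ENNReal.coe_ne_top
  have hfin : μH[n] D ≠ ⊤ := hD.measure_lt_top.ne
  have hlt : μH[n] D < μH[n] D + η / (κ + 1) :=
    ENNReal.lt_add_right hfin (ENNReal.div_ne_zero.2 ⟨hη, by finiteness⟩)
  have hev := (tendsto_measure_cthickening_of_isCompact (μ := μH[n]) hD).eventually_lt_const hlt
  obtain ⟨r, hr, hball⟩ := Metric.eventually_nhds_iff.1 hev
  refine ⟨min 1 (r / (2 * (c + 1))), by positivity, fun h hh hclose => ?_⟩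
  set δ := min 1 (r / (2 * ((c : ℝ) + 1)))
  have hδ0 : 0 ≤ δ := by positivity
  obtain ⟨k, hk, hkD, hkd, hks⟩ := hext δ hδ0 (min_le_left _ _) h hh hclose
  have hcδ : c * δ < r := by
    have h1 : δ * (2 * (c + 1)) ≤ r := (le_div_iff₀ (by positivity)).1 (min_le_right _ _)
    nlinarith [c.2]
  set U := cthickening (c * δ) D
  have hDU : D ⊆ U := self_subset_cthickening D
  have hUm : μH[n] (U \ D) ≤ η / (κ + 1) := by
    rw [measure_sdiff hDU hD.measurableSet.nullMeasurableSet hfin, tsub_le_iff_left]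
    refine (hball ?_).le
    rw [Real.dist_0_eq_abs, abs_of_nonneg (by positivity)]
    exact hcδ
  have hsub : D ⊆ h '' D ∪ k '' (U \ D) := by
    intro y hy
    obtain ⟨x, rfl⟩ := hks y
    by_cases hx : x ∈ D
    · exact Or.inl ⟨x, hx, hkD hx⟩
    · refine Or.inr ⟨x, ⟨?_, hx⟩, rfl⟩
      exact mem_cthickening_of_dist_le x _ _ D hy (by rw [dist_comm]; exact hkd x)
  have himg := hk.hausdorffMeasure_image_le (d := (n : ℝ)) (by positivity) (U \ D)
  rw [ENNReal.rpow_natCast] at himg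
  calc μH[n] D ≤ μH[n] (h '' D) + μH[n] (k '' (U \ D)) :=
        (measure_mono hsub).trans (measure_union_le _ _)
    _ ≤ μH[n] (h '' D) + η := by
        gcongr
        calc μH[n] (k '' (U \ D)) ≤ κ * (η / (κ + 1)) :=
              himg.trans (mul_le_mul_right hUm _)
          _ ≤ (κ + 1) * (η / (κ + 1)) := by gcongr; exact le_self_add
          _ = η := ENNReal.mul_div_cancel (by simp) (by finiteness)

/-- The image of `K` under `f` is the graph of a Lipschitz map over a subset of `ℝ^n`, parametrized
with distortion at most `Λ`, and `f` is bi-Lipschitz on `K`. -/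
def IsGraphOn (n : ℕ) {m : ℕ} {X : Type*} [MetricSpace X] (f : X → Euc m) (Λ : NNReal)
    (K : Set X) : Prop :=
  ∃ (M : NNReal) (p : Euc m → Euc n), LipschitzWith 1 p ∧ ∀ a ∈ K, ∀ b ∈ K,
    dist a b ≤ M * dist (p (f a)) (p (f b)) ∧ dist (f a) (f b) ≤ Λ * dist (p (f a)) (p (f b))

lemma IsGraphOn.mono {n m : ℕ} {X : Type*} [MetricSpace X] {f : X → Euc m} {Λ : NNReal}
    {K K' : Set X} (h : IsGraphOn n f Λ K) (hK : K' ⊆ K) : IsGraphOn n f Λ K' := by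
  obtain ⟨M, p, hp, h⟩ := h
  exact ⟨M, p, hp, fun a ha b hb => h a (hK ha) b (hK hb)⟩

lemma IsGraphOn.measure_image_lt_top {n m : ℕ} {X : Type*} [MetricSpace X] {f : X → Euc m}
    (hf : Continuous f) {Λ : NNReal} {K : Set X} (hK : IsCompact K) (h : IsGraphOn n f Λ K) :
    μH[n] (f '' K) < ⊤ := by
  have := isAddHaarMeasure_hausdorffMeasure_euc n
  obtain ⟨M, p, hp, h⟩ := h
  have hD : IsCompact ((fun a => p (f a)) '' K) := hK.image (hp.continuous.comp hf)
  have h1 := hausdorffMeasure_image_le_of_dist_le (fun a ha b hb => (h a ha b hb).2) n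
  exact h1.trans_lt (ENNReal.mul_lt_top (ENNReal.pow_lt_top ENNReal.coe_lt_top) hD.measure_lt_top)

lemma LipE.eventually_dist_le {L : NNReal} {X : Type*} [MetricSpace X] {m : ℕ} (f : LipE L X m)
    {δ : ℝ} (hδ : 0 < δ) : ∀ᶠ g in 𝓝 f, ∀ x, dist (g.1 x) (f.1 x) ≤ δ := by
  filter_upwards [Metric.closedBall_mem_nhds f hδ] with g hg x
  exact (BoundedContinuousFunction.dist_coe_le_dist x).trans hg

/-- Lower semicontinuity, up to the distortion, for a piece on which the limit map is almost
isometric to its projection to `ℝ^n`. -/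
lemma IsGraphOn.eventually_measure_image_le {n m : ℕ} {X : Type*} [MetricSpace X] {L : NNReal}
    {f : LipE L X m} {Λ : NNReal} {K : Set X} (hK : IsCompact K) (h : IsGraphOn n f.1 Λ K)
    {η : ℝ≥0∞} (hη : η ≠ 0) :
    ∀ᶠ g in 𝓝 f, μH[n] (f.1 '' K) ≤ (Λ : ℝ≥0∞) ^ n * (μH[n] (g.1 '' K) + η) := by
  obtain ⟨M, p, hp, h⟩ := h
  rcases K.eq_empty_or_nonempty with rfl | ⟨x₀, -⟩
  · simp
  have : Nonempty X := ⟨x₀⟩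
  set q : X → Euc n := fun a => p (f.1 a) with hq
  have hD : IsCompact (q '' K) := hK.image (hp.continuous.comp f.1.continuous)
  set s : Euc n → X := Function.invFunOn q K
  have hsK : ∀ y ∈ q '' K, s y ∈ K := fun y hy => Function.invFunOn_mem hy
  have hqs : ∀ y ∈ q '' K, q (s y) = y := fun y hy => Function.invFunOn_eq hy
  have hs : LipschitzOnWith M s (q '' K) := by
    refine LipschitzOnWith.of_dist_le_mul fun y hy z hz => ?_
    have := (h _ (hsK y hy) _ (hsK z hz)).1
    change _ ≤ M * dist (q (s y)) (q (s z)) at this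
    rwa [hqs y hy, hqs z hz] at this
  obtain ⟨δ, hδ, hclose⟩ := exists_measure_le_measure_image_add hD (1 * L * M) hη
  filter_upwards [LipE.eventually_dist_le f hδ] with g hg
  have h1 := hclose (p ∘ g.1 ∘ s)
    (((hp.comp g.2).comp_lipschitzOnWith hs)) (fun y hy => by
      have h2 := hp.dist_le_mul (g.1 (s y)) (f.1 (s y))
      rw [NNReal.coe_one, one_mul] at h2
      calc dist ((p ∘ g.1 ∘ s) y) y = dist (p (g.1 (s y))) (q (s y)) := by rw [hqs y hy]; rfl
        _ ≤ δ := h2.trans (hg _))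
  have h3 : μH[n] ((p ∘ g.1 ∘ s) '' (q '' K)) ≤ μH[n] (g.1 '' K) := by
    have h4 := hp.hausdorffMeasure_image_le (d := (n : ℝ)) (by positivity) (g.1 '' K)
    rw [ENNReal.coe_one, ENNReal.one_rpow, one_mul] at h4
    refine (measure_mono ?_).trans h4
    rintro _ ⟨y, hy, rfl⟩
    exact ⟨_, ⟨s y, hsK y hy, rfl⟩, rfl⟩
  calc μH[n] (f.1 '' K) ≤ (Λ : ℝ≥0∞) ^ n * μH[n] (q '' K) :=
        hausdorffMeasure_image_le_of_dist_le (fun a ha b hb => (h a ha b hb).2) n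
    _ ≤ _ := by gcongr; exact h1.trans (by gcongr)

lemma LipE.eventually_disjoint_image {L : NNReal} {X : Type*} [MetricSpace X] {m : ℕ}
    {f : LipE L X m} {K K' : Set X} (hK : IsCompact K) (hK' : IsCompact K')
    (h : Disjoint (f.1 '' K) (f.1 '' K')) :
    ∀ᶠ g in 𝓝 f, Disjoint ((g : LipE L X m).1 '' K) (g.1 '' K') := by
  obtain ⟨δ, hδ, hdisj⟩ := h.exists_cthickenings (hK.image f.1.continuous)
    (hK'.image f.1.continuous).isClosed
  filter_upwards [LipE.eventually_dist_le f hδ] with g hg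
  refine hdisj.mono ?_ ?_ <;>
  · rintro _ ⟨x, hx, rfl⟩
    exact mem_cthickening_of_dist_le _ _ _ _ ⟨x, hx, rfl⟩ (hg x)

/-- If the image of `f` is exhausted, up to a null set, by the images of countably many compact
pieces over which it is a graph of distortion at most `Λ`, then the area functional is lower
semicontinuous at `f` up to a factor `Λ ^ n`. -/
lemma eventually_lt_measure_image_of_pieces {n m : ℕ} {X : Type*} [MetricSpace X] {L : NNReal}
    {f : LipE L X m} {Λ : NNReal} {E : Set X} {K : ℕ → Set X} (hK : ∀ j, IsCompact (K j))
    (hKE : ∀ j, K j ⊆ E) (hgr : ∀ j, IsGraphOn n f.1 Λ (K j)) {c : ℝ≥0∞}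
    (hc : (Λ : ℝ≥0∞) ^ n * c < μH[n] (⋃ j, f.1 '' K j)) :
    ∀ᶠ g in 𝓝 f, c < μH[n] ((g : LipE L X m).1 '' E) := by
  set μ : Measure (Euc m) := μH[n] with hμ
  have hfK : ∀ j, IsCompact (f.1 '' K j) := fun j => (hK j).image f.1.continuous
  set Y : ℕ → Set (Euc m) := disjointed fun j => f.1 '' K j with hY
  have hYm : ∀ j, MeasurableSet (Y j) :=
    fun j => MeasurableSet.disjointed (fun i => (hfK i).measurableSet) j
  have hYd : Pairwise (Function.onFun Disjoint Y) := disjoint_disjointed _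
  have hYK : ∀ j, Y j ⊆ f.1 '' K j := fun j => disjointed_subset _ j
  rw [← iUnion_disjointed, measure_iUnion hYd hYm, ENNReal.tsum_eq_iSup_sum, lt_iSup_iff] at hc
  obtain ⟨s, hs⟩ := hc
  have hcont : Continuous fun η : ℝ≥0∞ => (Λ : ℝ≥0∞) ^ n * (c + 2 * s.card * η) :=
    (ENNReal.continuous_const_mul (ENNReal.pow_ne_top ENNReal.coe_ne_top)).comp
      (continuous_const.add (ENNReal.continuous_const_mul (by finiteness)))
  have hev : ∀ᶠ η : ℝ≥0∞ in 𝓝 0, (Λ : ℝ≥0∞) ^ n * (c + 2 * s.card * η) < ∑ j ∈ s, μ (Y j) :=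
    hcont.continuousAt.eventually_lt_const (by simpa using hs)
  obtain ⟨η, hη, hη0⟩ := ((hev.filter_mono nhdsWithin_le_nhds).and
    (self_mem_nhdsWithin : Ioi (0 : ℝ≥0∞) ∈ 𝓝[>] 0)).exists
  have hη0' : η ≠ 0 := (mem_Ioi.1 hη0).ne'
  have hcompact : ∀ j, ∃ Z ⊆ Y j, IsCompact Z ∧ μ (Y j) ≤ μ Z + (Λ : ℝ≥0∞) ^ n * η := by
    intro j
    by_cases hΛ : (Λ : ℝ≥0∞) ^ n * η = 0
    · refine ⟨∅, empty_subset _, isCompact_empty, ?_⟩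
      rw [mul_eq_zero, or_iff_left hη0'] at hΛ
      obtain ⟨M, p, hp, h⟩ := hgr j
      have h1 := hausdorffMeasure_image_le_of_dist_le (fun a ha b hb => (h a ha b hb).2) n
      rw [hΛ, zero_mul] at h1
      exact (measure_mono (hYK j)).trans (h1.trans zero_le)
    have hfin : Fact (μ (f.1 '' K j) < ⊤) :=
      ⟨(hgr j).measure_image_lt_top f.1.continuous (hK j)⟩
    obtain ⟨Z, hZ, hZc, hlt⟩ := (hYm j).exists_isCompact_sdiff_lt
      (μ := μ.restrict (f.1 '' K j)) (measure_ne_top _ _) hΛ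
    refine ⟨Z, hZ, hZc, ?_⟩
    rw [Measure.restrict_apply ((hYm j).diff hZc.measurableSet),
      inter_eq_left.2 (sdiff_subset.trans (hYK j))] at hlt
    calc μ (Y j) = μ (Z ∪ (Y j \ Z)) := by rw [union_sdiff_cancel hZ]
      _ ≤ μ Z + μ (Y j \ Z) := measure_union_le _ _
      _ ≤ _ := by gcongr
  choose Z hZY hZc hZμ using hcompact
  set K' : ℕ → Set X := fun j => K j ∩ f.1 ⁻¹' Z j with hK'
  have hK'c : ∀ j, IsCompact (K' j) :=
    fun j => (hK j).inter_right ((hZc j).isClosed.preimage f.1.continuous)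
  have himg : ∀ j, f.1 '' K' j = Z j := by
    intro j
    rw [hK', image_inter_preimage, inter_eq_right]
    exact (hZY j).trans (hYK j)
  have hev1 : ∀ᶠ g in 𝓝 f, ∀ j ∈ s,
      μ (f.1 '' K' j) ≤ (Λ : ℝ≥0∞) ^ n * (μ ((g : LipE L X m).1 '' K' j) + η) :=
    (Filter.eventually_all_finset s).2 fun j _ =>
      ((hgr j).mono inter_subset_left).eventually_measure_image_le (hK'c j) hη0'
  have hev2 : ∀ᶠ g in 𝓝 f, ∀ i ∈ s, ∀ j ∈ s, i ≠ j →
      Disjoint ((g : LipE L X m).1 '' K' i) (g.1 '' K' j) := by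
    refine (Filter.eventually_all_finset s).2 fun i _ =>
      (Filter.eventually_all_finset s).2 fun j _ => ?_
    by_cases hij : i = j
    · simp [hij]
    · have hd : Disjoint (f.1 '' K' i) (f.1 '' K' j) := by
        rw [himg, himg]
        exact (hYd hij).mono (hZY i) (hZY j)
      filter_upwards [LipE.eventually_disjoint_image (hK'c i) (hK'c j) hd] with g hg _
      exact hg
  filter_upwards [hev1, hev2] with g hg1 hg2
  have hsum : ∑ j ∈ s, μ (g.1 '' K' j) ≤ μ (g.1 '' E) := by
    rw [← measure_biUnion_finset (fun i hi j hj hij => hg2 i hi j hj hij)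
      (fun j _ => ((hK'c j).image g.1.continuous).measurableSet)]
    refine measure_mono (iUnion₂_subset fun j _ => image_mono ?_)
    exact inter_subset_left.trans (hKE j)
  by_contra! hcon
  refine absurd hη (not_lt.2 ?_)
  calc ∑ j ∈ s, μ (Y j)
      ≤ ∑ j ∈ s, ((Λ : ℝ≥0∞) ^ n * (μ (g.1 '' K' j) + η) + (Λ : ℝ≥0∞) ^ n * η) := by
        refine Finset.sum_le_sum fun j hj => (hZμ j).trans ?_
        gcongr
        rw [← himg j]
        exact hg1 j hj
    _ = (Λ : ℝ≥0∞) ^ n * (∑ j ∈ s, μ (g.1 '' K' j) + 2 * s.card * η) := by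
        simp_rw [mul_add, Finset.sum_add_distrib, ← Finset.mul_sum, Finset.sum_const, nsmul_eq_mul]
        ring
    _ ≤ _ := by gcongr; exact hsum.trans hcon

/-- A map which is almost linear with injective linear part has an image which is a graph of small
distortion over a subset of `ℝ^n`. -/
lemma exists_projection_of_approximatesLinearOn {n m : ℕ} (A : Euc n →L[ℝ] Euc m)
    (hA : Function.Injective A) {Λ : NNReal} (hΛ : 1 < Λ) :
    ∃ c : NNReal, c ≠ 0 ∧ ∀ (g : Euc n → Euc m) (S : Set (Euc n)), ApproximatesLinearOn g A S c →
      ∃ (M : NNReal) (p : Euc m → Euc n), LipschitzWith 1 p ∧ ∀ x ∈ S, ∀ y ∈ S,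
        dist x y ≤ M * dist (p (g x)) (p (g y)) ∧
        dist (g x) (g y) ≤ Λ * dist (p (g x)) (p (g y)) := by
  obtain ⟨κ, hκ, hanti⟩ := (A : Euc n →ₗ[ℝ] Euc m).exists_antilipschitzWith
    (LinearMap.ker_eq_bot.2 hA)
  have hκA : ∀ z, ‖z‖ ≤ κ * ‖A z‖ := fun z => by
    simpa using hanti.le_mul_dist z 0
  set V := LinearMap.range (A : Euc n →ₗ[ℝ] Euc m)
  have hrank : Module.finrank ℝ V = n := by
    rw [LinearMap.finrank_range_of_inj hA]; simp
  set U : V ≃ₗᵢ[ℝ] Euc n := ((stdOrthonormalBasis ℝ V).reindex (finCongr hrank)).repr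
  set p : Euc m →L[ℝ] Euc n := (U : V →L[ℝ] Euc n) ∘L V.orthogonalProjectionOnto with hp
  have hp1 : ∀ z, ‖p z‖ ≤ ‖z‖ := fun z => by
    simpa [hp] using V.norm_orthogonalProjectionOnto_apply_le z
  have hpA : ∀ z, ‖p (A z)‖ = ‖A z‖ := fun z => by
    have h1 : V.orthogonalProjectionOnto (A z) = ⟨A z, ⟨z, rfl⟩⟩ :=
      Submodule.orthogonalProjectionOnto_mem_subspace_eq_self (K := V) ⟨A z, ⟨z, rfl⟩⟩
    simp [hp, h1]
  have hΛ' : (1 : ℝ) < Λ := by exact_mod_cast hΛ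
  set ε : ℝ := (Λ - 1) / (Λ + 1) with hε
  have hε0 : 0 < ε := div_pos (by linarith) (by linarith)
  have hε1 : 1 - ε = 2 / (Λ + 1) := by rw [hε]; field_simp; ring
  have hε2 : 1 + ε = Λ * (1 - ε) := by rw [hε1, hε]; field_simp; ring
  have hε3 : 0 < 1 - ε := by rw [hε1]; positivity
  refine ⟨ε.toNNReal / κ, (div_pos (Real.toNNReal_pos.2 hε0) hκ).ne', fun g S hg =>
    ⟨κ / (1 - ε).toNNReal, p, ?_, fun x hx y hy => ?_⟩⟩
  · refine LipschitzWith.of_dist_le_mul fun a b => ?_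
    rw [dist_eq_norm, ← map_sub, NNReal.coe_one, one_mul, dist_eq_norm]
    exact hp1 _
  have h1 : ‖g x - g y - A (x - y)‖ ≤ ε * ‖A (x - y)‖ := by
    calc ‖g x - g y - A (x - y)‖ ≤ (ε.toNNReal / κ : NNReal) * ‖x - y‖ := hg x hx y hy
      _ ≤ (ε.toNNReal / κ : NNReal) * (κ * ‖A (x - y)‖) := by gcongr; exact hκA _
      _ = ε * ‖A (x - y)‖ := by
        have hκ' : (κ : ℝ) ≠ 0 := by exact_mod_cast hκ.ne'
        rw [NNReal.coe_div, Real.coe_toNNReal _ hε0.le]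
        field_simp
  have h2 : (1 - ε) * ‖A (x - y)‖ ≤ ‖p (g x) - p (g y)‖ := by
    have h3 : p (A (x - y)) = (p (g x) - p (g y)) - p (g x - g y - A (x - y)) := by
      simp only [map_sub]; abel
    have h4 := norm_sub_le (p (g x) - p (g y)) (p (g x - g y - A (x - y)))
    rw [← h3, hpA] at h4
    linarith [hp1 (g x - g y - A (x - y))]
  have h5 : ‖g x - g y‖ ≤ (1 + ε) * ‖A (x - y)‖ := by
    have h6 := norm_add_le (g x - g y - A (x - y)) (A (x - y))
    rw [sub_add_cancel] at h6
    linarith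
  simp only [dist_eq_norm]
  constructor
  · rw [NNReal.coe_div, Real.coe_toNNReal _ hε3.le, div_mul_eq_mul_div, le_div_iff₀ hε3]
    calc ‖x - y‖ * (1 - ε) ≤ κ * ‖A (x - y)‖ * (1 - ε) := by gcongr; exact hκA _
      _ = κ * ((1 - ε) * ‖A (x - y)‖) := by ring
      _ ≤ _ := by gcongr
  · calc ‖g x - g y‖ ≤ Λ * ((1 - ε) * ‖A (x - y)‖) := by rw [← mul_assoc, ← hε2]; exact h5
      _ ≤ _ := by gcongr

/-- A map which is almost linear with noninjective linear part contracts the measure of sets. -/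
lemma measure_image_le_of_approximatesLinearOn {n m : ℕ} (A : Euc n →L[ℝ] Euc m)
    (hA : ¬ Function.Injective A) {θ : NNReal} (hθ0 : 0 < θ) (hθ1 : θ ≤ 1) {g : Euc n → Euc m}
    {S : Set (Euc n)} (hg : ApproximatesLinearOn g A S θ) :
    μH[n] (g '' S) ≤ ((‖A‖₊ + 1) ^ n * θ : NNReal) * μH[n] S := by
  have := isAddHaarMeasure_hausdorffMeasure_euc n
  obtain ⟨e, he, hAe⟩ : ∃ e : Euc n, ‖e‖ = 1 ∧ A e = 0 := by
    obtain ⟨v, hv, hv0⟩ : ∃ v, A v = 0 ∧ v ≠ 0 := by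
      by_contra! hcon
      exact hA ((injective_iff_map_eq_zero A).2 hcon)
    refine ⟨‖v‖⁻¹ • v, ?_, by simp [hv]⟩
    rw [norm_smul, norm_inv, norm_norm, inv_mul_cancel₀ (norm_ne_zero_iff.2 hv0)]
  have hθ1' : (θ : ℝ) ≤ 1 := by exact_mod_cast hθ1
  have hθ0' : (0 : ℝ) < θ := by exact_mod_cast hθ0
  set φ : Module.Dual ℝ (Euc n) := (-(1 - (θ : ℝ))) • (innerSL ℝ e : Euc n →ₗ[ℝ] ℝ)
  set T := LinearMap.transvection φ e
  have hT : ∀ z, T z = z - ((1 - (θ : ℝ)) * inner ℝ e z) • e := fun z => by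
    simp [T, φ, LinearMap.transvection.apply, sub_eq_add_neg]
  have hdet : LinearMap.det T = θ := by
    rw [LinearMap.transvection.det]
    simp [φ, he]
  have hAT : ∀ z, A (T z) = A z := fun z => by rw [hT, map_sub, map_smul, hAe, smul_zero, sub_zero]
  have hθT : ∀ z, θ * ‖z‖ ≤ ‖T z‖ := fun z => by
    have h1 := norm_sub_norm_le z (((1 - (θ : ℝ)) * inner ℝ e z) • e)
    rw [← hT, norm_smul, he, mul_one, norm_mul, Real.norm_of_nonneg (by linarith)] at h1
    have h2 : ‖inner ℝ e z‖ ≤ ‖z‖ := by simpa [he] using norm_inner_le_norm (𝕜 := ℝ) e z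
    nlinarith
  have hlip : ∀ x ∈ S, ∀ y ∈ S, dist (g x) (g y) ≤ (‖A‖₊ + 1 : NNReal) * dist (T x) (T y) := by
    intro x hx y hy
    rw [dist_eq_norm, dist_eq_norm, ← map_sub T]
    have h1 : ‖g x - g y - A (x - y)‖ ≤ θ * ‖x - y‖ := hg x hx y hy
    have h2 := norm_add_le (g x - g y - A (x - y)) (A (x - y))
    rw [sub_add_cancel] at h2
    have h3 : ‖A (x - y)‖ ≤ ‖A‖ * ‖T (x - y)‖ := by rw [← hAT]; exact A.le_opNorm _
    push_cast
    linarith [hθT (x - y)]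
  refine (hausdorffMeasure_image_le_of_dist_le hlip n).trans_eq ?_
  rw [Measure.addHaar_image_linearMap, hdet, abs_of_pos hθ0', ENNReal.ofReal_coe_nnreal, ← mul_assoc]
  push_cast
  rfl

/-- A Sard-type statement: the image of the set of points where the derivative of
`g : ℝ^n → ℝ^m` is not injective is negligible for the `n`-dimensional measure. -/
lemma measure_image_eq_zero_of_not_injective {n m : ℕ} {g : Euc n → Euc m}
    {g' : Euc n → Euc n →L[ℝ] Euc m} {S : Set (Euc n)}
    (hg : ∀ x ∈ S, HasFDerivWithinAt g (g' x) S x)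
    (hinj : ∀ x ∈ S, ¬ Function.Injective (g' x)) : μH[n] (g '' S) = 0 := by
  have := isAddHaarMeasure_hausdorffMeasure_euc n
  wlog hb : μH[n] S ≠ ⊤ generalizing S
  · have hS : g '' S = ⋃ R : ℕ, g '' (S ∩ ball 0 R) := by
      rw [← image_iUnion, ← inter_iUnion, iUnion_ball_nat, inter_univ]
    rw [hS, measure_iUnion_null_iff]
    refine fun R => this (fun x hx => (hg x hx.1).mono inter_subset_left)
      (fun x hx => hinj x hx.1) ?_
    exact ((measure_mono inter_subset_right).trans_lt measure_ball_lt_top).ne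
  have key : ∀ ε : NNReal, 0 < ε → ε ≤ 1 → μH[n] (g '' S) ≤ ε * μH[n] S := by
    intro ε hε0 hε1
    set r : (Euc n →L[ℝ] Euc m) → NNReal := fun A => ε / (‖A‖₊ + 1) ^ n
    have hr0 : ∀ A, 0 < r A := fun A => by positivity
    have hr1 : ∀ A, r A ≤ 1 := fun A =>
      (div_le_self zero_le (one_le_pow₀ (by simp))).trans hε1
    obtain ⟨t, A, htd, htm, hSt, hA, hAS⟩ := exists_partition_approximatesLinearOn_of_hasFDerivWithinAt
      g S g' hg r (fun A => (hr0 A).ne')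
    rcases S.eq_empty_or_nonempty with rfl | hne
    · simp
    have hone : ∀ k, μH[n] (g '' (S ∩ t k)) ≤ ε * (μH[n] : Measure (Euc n)).restrict S (t k) := by
      intro k
      obtain ⟨y, hy, hAy⟩ := hAS hne k
      have h1 := measure_image_le_of_approximatesLinearOn (A k) (hAy ▸ hinj y hy) (hr0 (A k))
        (hr1 (A k)) (hA k)
      have h2 : (‖A k‖₊ + 1) ^ n * r (A k) = ε := mul_div_cancel₀ _ (by positivity)
      rwa [h2, inter_comm, ← Measure.restrict_apply (htm k), inter_comm] at h1
    calc μH[n] (g '' S) ≤ μH[n] (⋃ k, g '' (S ∩ t k)) := by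
          refine measure_mono ?_
          rw [← image_iUnion, ← inter_iUnion, inter_eq_left.2 hSt]
      _ ≤ ∑' k, μH[n] (g '' (S ∩ t k)) := measure_iUnion_le _
      _ ≤ ∑' k, ε * (μH[n] : Measure (Euc n)).restrict S (t k) := ENNReal.tsum_le_tsum hone
      _ = ε * (μH[n] : Measure (Euc n)).restrict S (⋃ k, t k) := by
          rw [ENNReal.tsum_mul_left, measure_iUnion htd htm]
      _ ≤ ε * μH[n] S := by
          exact mul_le_mul' le_rfl
            ((measure_mono (subset_univ _)).trans_eq (Measure.restrict_apply_univ _))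
  have hcont : Tendsto (fun ε : NNReal => (ε : ℝ≥0∞) * μH[n] S) (𝓝[>] 0) (𝓝 0) := by
    have h1 : Continuous fun ε : NNReal => (ε : ℝ≥0∞) * μH[n] S :=
      (ENNReal.continuous_mul_const hb).comp ENNReal.continuous_coe
    simpa using (h1.tendsto 0).mono_left nhdsWithin_le_nhds
  refine nonpos_iff_eq_zero.1 (ge_of_tendsto hcont ?_)
  filter_upwards [Ioc_mem_nhdsGT (zero_lt_one' NNReal)] with ε hε
  exact key ε hε.1 hε.2

/-- Approximate linearity on a set passes to its closure. -/
lemma ApproximatesLinearOn.closure_of_continuous {E F : Type*} [NormedAddCommGroup E]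
    [NormedSpace ℝ E] [NormedAddCommGroup F] [NormedSpace ℝ F] {g : E → F} {A : E →L[ℝ] F}
    {S : Set E} {c : NNReal} (h : ApproximatesLinearOn g A S c) (hg : Continuous g) :
    ApproximatesLinearOn g A (closure S) c := by
  have hcl : IsClosed {q : E × E | ‖g q.1 - g q.2 - A (q.1 - q.2)‖ ≤ c * ‖q.1 - q.2‖} :=
    isClosed_le (by fun_prop) (by fun_prop)
  have hsub : S ×ˢ S ⊆ {q : E × E | ‖g q.1 - g q.2 - A (q.1 - q.2)‖ ≤ c * ‖q.1 - q.2‖} :=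
    fun q hq => h q.1 hq.1 q.2 hq.2
  intro x hx y hy
  have hxy : (x, y) ∈ closure (S ×ˢ S) := by rw [closure_prod_eq]; exact ⟨hx, hy⟩
  exact closure_minimal hsub hcl hxy

/-- A Lipschitz map into a complete space extends to the closure. -/
lemma LipschitzOnWith.exists_extension_closure {α β : Type*} [MetricSpace α] [MetricSpace β]
    [CompleteSpace β] {f : α → β} {s : Set α} {K : NNReal} (hf : LipschitzOnWith K f s) :
    ∃ g : α → β, LipschitzOnWith K g (closure s) ∧ EqOn f g s := by
  have hlim : ∀ x ∈ closure s, Tendsto f (𝓝[s] x) (𝓝 (extendFrom s f x)) := by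
    intro x hx
    have hne : (𝓝[s] x).NeBot := mem_closure_iff_nhdsWithin_neBot.1 hx
    have hc : Cauchy (map f (𝓝[s] x)) := by
      have h1 : Cauchy (𝓝[s] x) := cauchy_nhds.mono nhdsWithin_le_nhds
      exact h1.map_of_le hf.uniformContinuousOn inf_le_right
    obtain ⟨y, hy⟩ := CompleteSpace.complete hc
    exact tendsto_extendFrom ⟨y, hy⟩
  refine ⟨extendFrom s f, LipschitzOnWith.of_dist_le_mul fun x hx y hy => ?_, fun x hx => ?_⟩
  · have hnx : (𝓝[s] x).NeBot := mem_closure_iff_nhdsWithin_neBot.1 hx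
    have hny : (𝓝[s] y).NeBot := mem_closure_iff_nhdsWithin_neBot.1 hy
    have h1 : Tendsto (fun q : α × α => dist (f q.1) (f q.2)) (𝓝[s] x ×ˢ 𝓝[s] y)
        (𝓝 (dist (extendFrom s f x) (extendFrom s f y))) :=
      ((hlim x hx).comp tendsto_fst).dist ((hlim y hy).comp tendsto_snd)
    have h2 : Tendsto (fun q : α × α => K * dist q.1 q.2) (𝓝[s] x ×ˢ 𝓝[s] y)
        (𝓝 (K * dist x y)) :=
      (((tendsto_fst.mono_right nhdsWithin_le_nhds).dist
        (tendsto_snd.mono_right nhdsWithin_le_nhds))).const_mul _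
    refine le_of_tendsto_of_tendsto h1 h2 ?_
    filter_upwards [prod_mem_prod self_mem_nhdsWithin self_mem_nhdsWithin] with q hq
    exact hf.dist_le_mul _ hq.1 _ hq.2
  · have h1 := hlim x (subset_closure hx)
    have hne : (𝓝[s] x).NeBot := mem_closure_iff_nhdsWithin_neBot.1 (subset_closure hx)
    exact tendsto_nhds_unique (hf.continuousOn x hx) h1

/-- Up to a null set, `S` is covered by the images under `f` of countably many compact subsets of
`E` over which `f` is a graph of distortion at most `Λ`. -/
def HasGraphCover (n : ℕ) {m : ℕ} {X : Type*} [MetricSpace X] (f : X → Euc m) (Λ : NNReal)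
    (E : Set X) (S : Set (Euc m)) : Prop :=
  ∃ 𝒦 : Set (Set X), 𝒦.Countable ∧ (∀ K ∈ 𝒦, IsCompact K ∧ K ⊆ E ∧ IsGraphOn n f Λ K) ∧
    μH[n] (S \ ⋃ K ∈ 𝒦, f '' K) = 0

lemma HasGraphCover.mono {n m : ℕ} {X : Type*} [MetricSpace X] {f : X → Euc m} {Λ : NNReal}
    {E : Set X} {S S' : Set (Euc m)} (h : HasGraphCover n f Λ E S) (hS : S' ⊆ S) :
    HasGraphCover n f Λ E S' := by
  obtain ⟨𝒦, h1, h2, h3⟩ := h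
  exact ⟨𝒦, h1, h2, measure_mono_null (sdiff_subset_sdiff_left hS) h3⟩

lemma HasGraphCover.of_null {n m : ℕ} {X : Type*} [MetricSpace X] {f : X → Euc m} {Λ : NNReal}
    {E : Set X} {S : Set (Euc m)} (h : μH[n] S = 0) : HasGraphCover n f Λ E S :=
  ⟨∅, countable_empty, by simp, by simpa using h⟩

lemma HasGraphCover.iUnion {n m : ℕ} {X : Type*} [MetricSpace X] {f : X → Euc m} {Λ : NNReal}
    {E : Set X} {S : ℕ → Set (Euc m)} (h : ∀ i, HasGraphCover n f Λ E (S i)) :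
    HasGraphCover n f Λ E (⋃ i, S i) := by
  choose 𝒦 h1 h2 h3 using h
  refine ⟨⋃ i, 𝒦 i, countable_iUnion h1, fun K hK => ?_, ?_⟩
  · obtain ⟨i, hi⟩ := mem_iUnion.1 hK
    exact h2 i K hi
  · rw [iUnion_sdiff]
    refine measure_iUnion_null fun i => measure_mono_null (sdiff_subset_sdiff_right ?_) (h3 i)
    exact biUnion_subset_biUnion_left (subset_iUnion 𝒦 i)

lemma HasGraphCover.union {n m : ℕ} {X : Type*} [MetricSpace X] {f : X → Euc m} {Λ : NNReal}
    {E : Set X} {S S' : Set (Euc m)} (h : HasGraphCover n f Λ E S)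
    (h' : HasGraphCover n f Λ E S') : HasGraphCover n f Λ E (S ∪ S') := by
  refine (HasGraphCover.iUnion (S := fun i : ℕ => if i = 0 then S else S') fun i => ?_).mono ?_
  · split_ifs
    · exact h
    · exact h'
  · exact union_subset (subset_iUnion_of_subset 0 (by simp)) (subset_iUnion_of_subset 1 (by simp))

/-- A measurable subset of `ℝ^n` is exhausted by countably many compact subsets up to a null
set. -/
lemma exists_isCompact_seq_measure_sdiff_eq_zero {n : ℕ} {C : Set (Euc n)}
    (hC : MeasurableSet C) :
    ∃ D : ℕ → Set (Euc n), (∀ i, IsCompact (D i) ∧ D i ⊆ C) ∧ μH[n] (C \ ⋃ i, D i) = 0 := by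
  have := isAddHaarMeasure_hausdorffMeasure_euc n
  have hfin : ∀ R : ℕ, μH[n] (C ∩ ball 0 R) ≠ ⊤ := fun R =>
    ((measure_mono inter_subset_right).trans_lt measure_ball_lt_top).ne
  have hex : ∀ q : ℕ × ℕ, ∃ D ⊆ C ∩ ball 0 q.1, IsCompact D ∧
      μH[n] ((C ∩ ball 0 q.1) \ D) < ((q.2 : ℝ≥0∞) + 1)⁻¹ := fun q =>
    (hC.inter measurableSet_ball).exists_isCompact_sdiff_lt (hfin q.1)
      (ENNReal.inv_ne_zero.2 (by finiteness))
  choose D hDC hDc hDμ using hex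
  refine ⟨fun i => D i.unpair, fun i => ⟨hDc _, (hDC _).trans inter_subset_left⟩, ?_⟩
  have hcover : C \ ⋃ i : ℕ, D i.unpair ⊆ ⋃ R : ℕ, (C ∩ ball 0 R) \ ⋃ i : ℕ, D i.unpair := by
    rw [← iUnion_sdiff, ← inter_iUnion, iUnion_ball_nat, inter_univ]
  refine measure_mono_null hcover (measure_iUnion_null fun R => ?_)
  refine nonpos_iff_eq_zero.1 (ge_of_tendsto' (x := atTop)
    (f := fun k : ℕ => ((k : ℝ≥0∞) + 1)⁻¹) ?_ fun k => ?_)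
  · have := (ENNReal.tendsto_inv_nat_nhds_zero).comp (tendsto_add_atTop_nat 1)
    simpa [Function.comp_def] using this
  · refine (measure_mono (sdiff_subset_sdiff_right ?_)).trans (hDμ (R, k)).le
    exact subset_iUnion_of_subset (Nat.pair R k) (by simp)

/-- A Lipschitz image in `X` of a subset of `ℝ^n` has a graph cover, if the part of the
parameter set which is mapped to `E` is measurable. -/
lemma hasGraphCover_image {n m : ℕ} {X : Type*} [MetricSpace X] {f : X → Euc m}
    {L : NNReal} (hf : LipschitzWith L f) {Λ : NNReal} (hΛ : 1 < Λ) {E : Set X}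
    {φ : Euc n → X} {K : NNReal} {G : Set (Euc n)} (hG : MeasurableSet G)
    (hφ : LipschitzOnWith K φ G) (hGE : φ '' G ⊆ E) :
    HasGraphCover n f Λ E (f '' (φ '' G)) := by
  have := isAddHaarMeasure_hausdorffMeasure_euc n
  obtain ⟨g, hg, hfg⟩ := (hf.comp_lipschitzOnWith hφ).extend_finite_dimension
  have himg : ∀ S ⊆ G, f '' (φ '' S) = g '' S := fun S hS => by
    rw [image_image]
    exact image_congr fun x hx => hfg (hS hx)
  rw [himg G Subset.rfl]
  set S₀ : Set (Euc n) := {x | DifferentiableAt ℝ g x ∧ ¬ Function.Injective (fderiv ℝ g x)}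
  set S₁ : Set (Euc n) := {x | DifferentiableAt ℝ g x ∧ Function.Injective (fderiv ℝ g x)}
  have hnull : μH[n] (g '' {x | ¬ DifferentiableAt ℝ g x}) = 0 := by
    have hae : ∀ᵐ x ∂(μH[n] : Measure (Euc n)), DifferentiableAt ℝ g x := hg.ae_differentiableAt
    have h1 := hg.hausdorffMeasure_image_le (d := (n : ℝ)) (by positivity)
      {x | ¬ DifferentiableAt ℝ g x}
    rw [show μH[n] {x | ¬ DifferentiableAt ℝ g x} = 0 from hae, mul_zero] at h1
    exact nonpos_iff_eq_zero.1 h1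
  have hsard : μH[n] (g '' S₀) = 0 :=
    measure_image_eq_zero_of_not_injective (g' := fderiv ℝ g)
      (fun x hx => hx.1.hasFDerivAt.hasFDerivWithinAt) (fun x hx => hx.2)
  have hproj : ∀ A : Euc n →L[ℝ] Euc m, ∃ c : NNReal, c ≠ 0 ∧ (Function.Injective A →
      ∀ (g : Euc n → Euc m) (S : Set (Euc n)), ApproximatesLinearOn g A S c →
      ∃ (M : NNReal) (p : Euc m → Euc n), LipschitzWith 1 p ∧ ∀ x ∈ S, ∀ y ∈ S,
        dist x y ≤ M * dist (p (g x)) (p (g y)) ∧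
        dist (g x) (g y) ≤ Λ * dist (p (g x)) (p (g y))) := by
    intro A
    by_cases hA : Function.Injective A
    · obtain ⟨c, hc, h⟩ := exists_projection_of_approximatesLinearOn A hA hΛ
      exact ⟨c, hc, fun _ => h⟩
    · exact ⟨1, one_ne_zero, fun h => absurd h hA⟩
  choose r hr hproj using hproj
  obtain ⟨t, A, -, -, hSt, hA, hAS⟩ := exists_partition_approximatesLinearOn_of_hasFDerivWithinAt
    g S₁ (fderiv ℝ g) (fun x hx => hx.1.hasFDerivAt.hasFDerivWithinAt) r hr
  have hinj : HasGraphCover n f Λ E (g '' (S₁ ∩ G)) := by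
    rcases S₁.eq_empty_or_nonempty with he | hne
    · rw [he]; exact HasGraphCover.of_null (by simp)
    refine (HasGraphCover.iUnion (S := fun k => g '' (closure (S₁ ∩ t k) ∩ G)) fun k => ?_).mono ?_
    · obtain ⟨y, hy, hAy⟩ := hAS hne k
      obtain ⟨M, p, hp, h⟩ := hproj (A k) (hAy ▸ hy.2) g _
        ((hA k).closure_of_continuous hg.continuous)
      obtain ⟨D, hD, hDnull⟩ := exists_isCompact_seq_measure_sdiff_eq_zero
        (isClosed_closure.measurableSet.inter hG : MeasurableSet (closure (S₁ ∩ t k) ∩ G))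
      have hDG : ∀ i, D i ⊆ G := fun i => (hD i).2.trans inter_subset_right
      refine ⟨range fun i => φ '' D i, countable_range _, ?_, ?_⟩
      · rintro _ ⟨i, rfl⟩
        refine ⟨(hD i).1.image_of_continuousOn (hφ.continuousOn.mono (hDG i)),
          (image_mono (hDG i)).trans hGE, K * M, p, hp, ?_⟩
        rintro _ ⟨x, hx, rfl⟩ _ ⟨y, hy, rfl⟩
        have hfx : f (φ x) = g x := hfg (hDG i hx)
        have hfy : f (φ y) = g y := hfg (hDG i hy)
        have hxy := h x ((hD i).2 hx).1 y ((hD i).2 hy).1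
        rw [hfx, hfy]
        refine ⟨?_, hxy.2⟩
        calc dist (φ x) (φ y) ≤ K * dist x y := hφ.dist_le_mul _ (hDG i hx) _ (hDG i hy)
          _ ≤ K * (M * dist (p (g x)) (p (g y))) := by gcongr; exact hxy.1
          _ = _ := by push_cast; ring
      · have h1 := hg.hausdorffMeasure_image_le (d := (n : ℝ)) (by positivity)
          ((closure (S₁ ∩ t k) ∩ G) \ ⋃ i, D i)
        rw [hDnull, mul_zero] at h1
        refine measure_mono_null ?_ (nonpos_iff_eq_zero.1 h1)
        rw [biUnion_range]
        simp_rw [fun i => himg (D i) (hDG i)]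
        rw [← image_iUnion]
        rintro _ ⟨⟨x, hx, rfl⟩, hn⟩
        exact ⟨x, ⟨hx, fun h => hn ⟨x, h, rfl⟩⟩, rfl⟩
    · rw [← image_iUnion]
      refine image_mono fun x hx => ?_
      obtain ⟨k, hk⟩ := mem_iUnion.1 (hSt hx.1)
      exact mem_iUnion.2 ⟨k, subset_closure ⟨hx.1, hk⟩, hx.2⟩
  refine (((HasGraphCover.of_null hnull).union (HasGraphCover.of_null hsard)).union hinj).mono ?_
  rintro _ ⟨x, hx, rfl⟩
  by_cases hd : DifferentiableAt ℝ g x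
  · by_cases hi : Function.Injective (fderiv ℝ g x)
    · exact Or.inr ⟨x, ⟨⟨hd, hi⟩, hx⟩, rfl⟩
    · exact Or.inl (Or.inr ⟨x, ⟨hd, hi⟩, rfl⟩)
  · exact Or.inl (Or.inl ⟨x, hd, rfl⟩)

/-- Lipschitz images of rectifiable sets have graph covers of distortion arbitrarily close
to `1`. -/
lemma IsRectifiable.hasGraphCover {n m : ℕ} {X : Type*} [MetricSpace X] [CompleteSpace X]
    [MeasurableSpace X] [BorelSpace X] {E : Set X} (hE : IsRectifiable n E) {f : X → Euc m}
    {L : NNReal} (hf : LipschitzWith L f) {Λ : NNReal} (hΛ : 1 < Λ) :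
    HasGraphCover n f Λ E (f '' E) := by
  obtain ⟨hEm, F, ψ, K, hψ, hcover⟩ := hE
  obtain ⟨E', hE'E, hE'm, hE'ae⟩ := hEm.exists_measurable_subset_ae_eq
  have hEE' : μH[n] (E \ E') = 0 := (ae_le_set.1 hE'ae.symm.le)
  have hnull : ∀ N : Set X, μH[n] N = 0 → μH[n] (f '' N) = 0 := fun N hN => by
    have h1 := hf.hausdorffMeasure_image_le (d := (n : ℝ)) (by positivity) N
    rw [hN, mul_zero] at h1
    exact nonpos_iff_eq_zero.1 h1
  have hpiece : ∀ i, HasGraphCover n f Λ E (f '' (E' ∩ ψ i '' F i)) := by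
    intro i
    obtain ⟨φ, hφ, hφψ⟩ := (hψ i).exists_extension_closure
    have hG : MeasurableSet (closure (F i) ∩ φ ⁻¹' E') := by
      have h1 : MeasurableSet ((closure (F i)).domRestrict φ ⁻¹' E') :=
        (continuousOn_iff_continuous_domRestrict.1 hφ.continuousOn).measurable hE'm
      have h2 := isClosed_closure.measurableSet.subtype_image h1
      rwa [domRestrict_eq, preimage_comp, Subtype.image_preimage_coe] at h2
    refine (hasGraphCover_image hf hΛ hG (hφ.mono inter_subset_left) ?_).mono ?_
    · rintro _ ⟨x, hx, rfl⟩
      exact hE'E hx.2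
    · refine image_mono ?_
      rintro _ ⟨hxE, x, hx, rfl⟩
      refine ⟨x, ⟨subset_closure hx, ?_⟩, (hφψ hx).symm⟩
      rw [mem_preimage, ← hφψ hx]
      exact hxE
  refine (((HasGraphCover.of_null (hnull _ hcover)).union
    (HasGraphCover.of_null (hnull _ hEE'))).union (HasGraphCover.iUnion hpiece)).mono ?_
  rintro _ ⟨x, hx, rfl⟩
  by_cases hxE : x ∈ E'
  · by_cases hxi : x ∈ ⋃ i, ψ i '' F i
    · obtain ⟨i, hi⟩ := mem_iUnion.1 hxi
      exact Or.inr (mem_iUnion.2 ⟨i, x, ⟨hxE, hi⟩, rfl⟩)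
    · exact Or.inl (Or.inl ⟨x, ⟨hx, hxi⟩, rfl⟩)
  · exact Or.inl (Or.inr ⟨x, ⟨hx, hxE⟩, rfl⟩)

/-- Let `X` be a complete metric space, `E ⊆ X` an `n`-rectifiable subset
(`n ≤ m`), `L ≥ 0`. The area functional `f ↦ H^n(f(E))` is lower semicontinuous on
`Lip_L(X, ℝ^m)` with the supremum metric. -/
theorem stmt10 (n m : ℕ) (hnm : n ≤ m)
    (X : Type*) [MetricSpace X] [CompleteSpace X] [MeasurableSpace X] [BorelSpace X]
    (E : Set X) (hE : IsRectifiable n E) (L : NNReal) :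
    LowerSemicontinuous (fun f : LipE L X m => μH[n] (⇑f.1 '' E)) := by
  intro f c hc
  have hcont : Continuous fun Λ : NNReal => (Λ : ℝ≥0∞) ^ n * c := by
    have hc' : c ≠ ⊤ := (hc.trans_le le_top).ne
    exact (ENNReal.continuous_mul_const hc').comp
      ((ENNReal.continuous_pow n).comp ENNReal.continuous_coe)
  have hev : ∀ᶠ Λ : NNReal in 𝓝 1, (Λ : ℝ≥0∞) ^ n * c < μH[n] (⇑f.1 '' E) :=
    hcont.continuousAt.eventually_lt_const (by simpa using hc)
  obtain ⟨Λ, hΛc, hΛ⟩ := ((hev.filter_mono nhdsWithin_le_nhds).and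
    (self_mem_nhdsWithin : Ioi (1 : NNReal) ∈ 𝓝[>] 1)).exists
  obtain ⟨𝒦, h𝒦c, h𝒦, hnull⟩ := hE.hasGraphCover f.2 (mem_Ioi.1 hΛ)
  obtain ⟨K, hK⟩ := (h𝒦c.insert ∅).exists_eq_range (insert_nonempty _ _)
  have hprop : ∀ j, IsCompact (K j) ∧ K j ⊆ E ∧ IsGraphOn n f.1 Λ (K j) := by
    intro j
    rcases (hK ▸ mem_range_self j : K j ∈ insert ∅ 𝒦) with h | h
    · rw [h]
      exact ⟨isCompact_empty, empty_subset _, 0, fun _ => 0, LipschitzWith.const' 0, by simp⟩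
    · exact h𝒦 _ h
  refine eventually_lt_measure_image_of_pieces (K := K) (fun j => (hprop j).1)
    (fun j => (hprop j).2.1) (fun j => (hprop j).2.2) (hΛc.trans_le ?_)
  have hsub : ⋃ S ∈ 𝒦, f.1 '' S ⊆ ⋃ j, f.1 '' K j := by
    refine iUnion₂_subset fun S hS => ?_
    obtain ⟨j, rfl⟩ := (hK ▸ mem_insert_of_mem ∅ hS : S ∈ range K)
    exact subset_iUnion (fun j => f.1 '' K j) j
  calc μH[n] (f.1 '' E) ≤ μH[n] ((⋃ j, f.1 '' K j) ∪ (f.1 '' E \ ⋃ S ∈ 𝒦, f.1 '' S)) := by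
        refine measure_mono fun y hy => ?_
        by_cases h : y ∈ ⋃ S ∈ 𝒦, f.1 '' S
        · exact Or.inl (hsub h)
        · exact Or.inr ⟨hy, h⟩
    _ ≤ μH[n] (⋃ j, f.1 '' K j) + 0 := hnull ▸ measure_union_le _ _
    _ = _ := add_zero _
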